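/- arXiv:2301.00226 — 4 statements merged into one kernel-verified Lean document; each statement's English description precedes it below -/
import Mathlib

section
/- Let s ≥ 1 be a real number, let α₋, α₊ > 0, and let κ₋ ∈ ℝ with κ₊ := −κ₋ satisfy |κ₋| ≤ 2α₋ + min{1, √α₋}/(4s) and |κ₊| ≤ 2α₊ + min{1, √α₊}/(4s). Let f : ℝ → ℝ be differentiable on [0,1] with derivative f' whose square is integrable on [0,1]. Then there exists i ∈ {0,1} such that min{α₋, α₊}·s·f(i)² ≤ (5/16)·∫_0^1 f'(z)² dz + (2α₋+κ₋)·s·f(0)² + (2α₊+κ₊)·s·f(1)². -/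
/-- The squared increment of a function over `[0,1]` is at most its Dirichlet energy. -/
theorem sq_sub_le_integral_deriv_sq {f f' : ℝ → ℝ}
    (hderiv : ∀ x ∈ Set.Icc (0:ℝ) 1, HasDerivWithinAt f (f' x) (Set.Icc (0:ℝ) 1) x)
    (hint : IntervalIntegrable (fun z => (f' z) ^ 2) MeasureTheory.volume 0 1) :
    (f 1 - f 0) ^ 2 ≤ ∫ z in (0:ℝ)..1, (f' z) ^ 2 := by
  set c := f 1 - f 0 with hc
  have hcont : ContinuousOn (fun x => 2 * c * f x) (Set.Icc (0:ℝ) 1) :=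
    continuousOn_const.mul fun x hx => (hderiv x hx).continuousWithinAt
  have hint' : IntervalIntegrable (fun z => (f' z) ^ 2 + c ^ 2) MeasureTheory.volume 0 1 :=
    hint.add intervalIntegrable_const
  have key := intervalIntegral.sub_le_integral_of_hasDeriv_right_of_le zero_le_one hcont
    (g' := fun x => 2 * c * f' x) (φ := fun z => (f' z) ^ 2 + c ^ 2)
    (fun x hx => (((hderiv x (Set.Ioo_subset_Icc_self hx)).hasDerivAt
      (Icc_mem_nhds hx.1 hx.2)).const_mul (2 * c)).hasDerivWithinAt)
    ((intervalIntegrable_iff_integrableOn_Icc_of_le zero_le_one).1 hint')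
    (fun x _ => by nlinarith [sq_nonneg (f' x - c)])
  rw [intervalIntegral.integral_add hint intervalIntegrable_const] at key
  simp only [intervalIntegral.integral_const, sub_zero, one_smul] at key
  nlinarith [key]

/-- Absorption of the boundary value on the side where the curvature `k` is nonnegative. -/
theorem mul_sq_le_of_curvature_nonneg {s α β k m a b e : ℝ} (hs : 1 ≤ s) (hα : 0 < α)
    (hβ : 0 < β) (hk : 0 ≤ k) (hkβ : k ≤ 2 * β + min 1 (Real.sqrt β) / (4 * s)) (hm : m ≤ α)
    (he : (b - a) ^ 2 ≤ e) :
    m * s * a ^ 2 ≤ 5 / 16 * e + (2 * α + k) * s * a ^ 2 + (2 * β - k) * s * b ^ 2 := by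
  have hs0 : 0 < s := by linarith
  have hms : m * s * a ^ 2 ≤ α * s * a ^ 2 := by gcongr
  have hαs : 0 ≤ α * s * a ^ 2 := by positivity
  have he0 : 0 ≤ e := (sq_nonneg _).trans he
  rcases le_total k (2 * β) with h | h
  · have h1 : 0 ≤ (2 * β - k) * s * b ^ 2 :=
      mul_nonneg (mul_nonneg (sub_nonneg.2 h) hs0.le) (sq_nonneg b)
    have h2 : 0 ≤ k * s * a ^ 2 := by positivity
    linarith
  · obtain ⟨r, hr⟩ : ∃ r, r = (k - 2 * β) * s := ⟨_, rfl⟩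
    have hr0 : 0 ≤ r := hr ▸ mul_nonneg (sub_nonneg.2 h) hs0.le
    have hrt : 4 * r ≤ min 1 (Real.sqrt β) := by
      have h1 := (le_div_iff₀ (by positivity)).1 (sub_le_iff_le_add'.2 hkβ)
      linarith
    have hr1 : 4 * r ≤ 1 := hrt.trans (min_le_left _ _)
    have hrβ : (4 * r) ^ 2 ≤ β :=
      (Real.le_sqrt (by positivity) hβ.le).1 (hrt.trans (min_le_right _ _))
    have hβs : (4 * r) ^ 2 * a ^ 2 ≤ β * s * a ^ 2 := by
      gcongr
      nlinarith
    have hd : r * (b - a) ^ 2 ≤ 1 / 4 * (b - a) ^ 2 := by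
      gcongr
      linarith
    have hβ0 : 0 ≤ β * s * a ^ 2 := by positivity
    have hks : k * s = r + 2 * β * s := by rw [hr]; ring
    have e1 : (2 * α + k) * s * a ^ 2 = 2 * (α * s * a ^ 2) + r * a ^ 2 + 2 * (β * s * a ^ 2) := by
      linear_combination a ^ 2 * hks
    have e2 : (2 * β - k) * s * b ^ 2 = -(r * b ^ 2) := by
      linear_combination -b ^ 2 * hks
    rw [e1, e2]
    linarith [sq_nonneg ((b - a) / 4 - 4 * r * a)]


/-- One boundary value of `f²`, weighted by `min{α₋,α₊}·s`, can be absorbed into the sum of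
the weighted boundary terms `(2α+κ)·s·f²` plus `5/16` of the Dirichlet energy, provided the
curvature values `κ₊ = −κ₋` satisfy `|κ| ≤ 2α + min{1,√α}/(4s)`. -/
theorem stmt2 (s αm αp κm : ℝ) (hs : 1 ≤ s) (hαm : 0 < αm) (hαp : 0 < αp)
    (hκm : |κm| ≤ 2 * αm + min 1 (Real.sqrt αm) / (4 * s))
    (hκp : |(-κm)| ≤ 2 * αp + min 1 (Real.sqrt αp) / (4 * s))
    (f f' : ℝ → ℝ)
    (hderiv : ∀ x ∈ Set.Icc (0:ℝ) 1, HasDerivWithinAt f (f' x) (Set.Icc (0:ℝ) 1) x)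
    (hint : IntervalIntegrable (fun z => (f' z) ^ 2) MeasureTheory.volume 0 1) :
    ∃ i ∈ ({0, 1} : Set ℝ),
      min αm αp * s * f i ^ 2 ≤
        (5 / 16) * (∫ z in (0:ℝ)..1, (f' z) ^ 2)
          + (2 * αm + κm) * s * f 0 ^ 2 + (2 * αp + (-κm)) * s * f 1 ^ 2 := by
  have he := sq_sub_le_integral_deriv_sq hderiv hint
  rcases le_total 0 κm with hk | hk
  · refine ⟨0, by simp, ?_⟩
    rw [abs_neg, abs_of_nonneg hk] at hκp
    have h := mul_sq_le_of_curvature_nonneg hs hαm hαp hk hκp (min_le_left αm αp) he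
    linarith
  · refine ⟨1, by simp, ?_⟩
    rw [abs_of_nonpos hk] at hκm
    rw [← neg_sq, neg_sub] at he
    have h := mul_sq_le_of_curvature_nonneg hs hαp hαm (neg_nonneg.2 hk) hκm
      (min_le_right αm αp) he
    linarith
end

section
/- Let s ≥ 1 be a real number, let α₋, α₊ > 0 with ᾱ := min{α₋, α₊}, and let κ₋ ∈ ℝ with κ₊ := −κ₋ satisfy |κ₋| ≤ 2α₋ + min{1, √α₋}/(4s) and |κ₊| ≤ 2α₊ + min{1, √α₊}/(4s). Let f : ℝ → ℝ be differentiable on [0,1] with derivative f' whose square is integrable on [0,1]. Then (3/4)·∫_0^1 f'(z)² dz + (2α₋+κ₋)·s·f(0)² + (2α₊+κ₊)·s·f(1)² ≥ (1/4)·min{1, ᾱ}·( ∫_0^1 f(y)² dy + ∫_0^1 f'(z)² dz ). -/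
open MeasureTheory Set

/-- A function with square-integrable derivative is Hölder continuous of exponent `1/2`. -/
theorem sq_sub_le_mul_integral_sq_deriv {f f' : ℝ → ℝ} {a b x y : ℝ}
    (hderiv : ∀ z ∈ Icc a b, HasDerivWithinAt f (f' z) (Icc a b) z)
    (hint : IntervalIntegrable (fun z => f' z ^ 2) volume a b)
    (hax : a ≤ x) (hxy : x ≤ y) (hyb : y ≤ b) :
    (f y - f x) ^ 2 ≤ (y - x) * ∫ z in a..b, f' z ^ 2 := by
  rcases hxy.eq_or_lt with rfl | hlt
  · simp
  have hab : a ≤ b := hax.trans (hxy.trans hyb)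
  have hsub : Icc x y ⊆ Icc a b := Icc_subset_Icc hax hyb
  have hat : ∀ z ∈ Ioo x y, HasDerivAt f (f' z) z := fun z hz =>
    (hderiv z (hsub (Ioo_subset_Icc_self hz))).hasDerivAt
      (Icc_mem_nhds (hax.trans_lt hz.1) (hz.2.trans_le hyb))
  have hcont : ContinuousOn f (Icc x y) := fun z hz =>
    (hderiv z (hsub hz)).continuousWithinAt.mono hsub
  have hsq : IntervalIntegrable (fun z => f' z ^ 2) volume x y :=
    hint.mono_set (by rwa [uIcc_of_le hxy, uIcc_of_le hab])
  have hmeas : AEStronglyMeasurable f' (volume.restrict (Ioc x y)) := by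
    rw [← restrict_Ioo_eq_restrict_Ioc]
    refine (measurable_deriv f).aestronglyMeasurable.congr ?_
    filter_upwards [ae_restrict_mem measurableSet_Ioo] with z hz using (hat z hz).deriv
  have hf' : IntervalIntegrable f' volume x y := by
    rw [intervalIntegrable_iff_integrableOn_Ioc_of_le hxy] at hsq ⊢
    exact ((memLp_two_iff_integrable_sq hmeas).2 hsq).integrable (by norm_num)
  have hftc : ∫ z in x..y, f' z = f y - f x :=
    intervalIntegral.integral_eq_sub_of_hasDerivAt_of_le hxy hcont hat hf'
  have hle : ∫ z in x..y, f' z ^ 2 ≤ ∫ z in a..b, f' z ^ 2 :=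
    intervalIntegral.integral_mono_interval hax hxy hyb
      (Filter.Eventually.of_forall fun z => sq_nonneg (f' z)) hint
  set t := (f y - f x) / (y - x) with ht
  have hpos : 0 < y - x := sub_pos.2 hlt
  have hexp : ∫ z in x..y, (f' z - t) ^ 2 =
      (∫ z in x..y, f' z ^ 2) - 2 * t * (f y - f x) + t ^ 2 * (y - x) := by
    have hpt : ∀ z, (f' z - t) ^ 2 = f' z ^ 2 - 2 * t * f' z + t ^ 2 := fun z => by ring
    simp_rw [hpt]
    rw [intervalIntegral.integral_add (hsq.sub (hf'.const_mul _)) (by simp),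
      intervalIntegral.integral_sub hsq (hf'.const_mul _),
      intervalIntegral.integral_const_mul, hftc, intervalIntegral.integral_const, smul_eq_mul]
    ring
  have hnn : 0 ≤ ∫ z in x..y, (f' z - t) ^ 2 :=
    intervalIntegral.integral_nonneg hxy fun z _ => sq_nonneg _
  have htd : f y - f x = t * (y - x) := by rw [ht]; field_simp
  rw [hexp, htd] at hnn
  rw [htd]
  nlinarith [mul_le_mul_of_nonneg_left hle hpos.le, mul_nonneg hpos.le hnn]

/-- A weighted pointwise bound on `(f - c) ^ 2` controls the `L²` norm of `f` on `[0, 1]`. -/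
theorem integral_sq_le_of_sq_sub_le {f : ℝ → ℝ} {c D w : ℝ} {g : ℝ → ℝ}
    (hf : ContinuousOn f (Icc 0 1)) (hg : Continuous g) (hgint : ∫ y in (0 : ℝ)..1, g y = w)
    (h : ∀ y ∈ Icc (0 : ℝ) 1, (f y - c) ^ 2 ≤ g y * D) :
    ∫ y in (0 : ℝ)..1, f y ^ 2 ≤ 4 * c ^ 2 + 4 / 3 * (w * D) := by
  have hfi : IntervalIntegrable (fun y => f y ^ 2) volume 0 1 :=
    ContinuousOn.intervalIntegrable (by rw [uIcc_of_le zero_le_one]; exact hf.pow 2)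
  have hgi : IntervalIntegrable g volume 0 1 := hg.intervalIntegrable 0 1
  have hmono : ∫ y in (0 : ℝ)..1, f y ^ 2 ≤
      ∫ y in (0 : ℝ)..1, (4 * c ^ 2 + 4 / 3 * (g y * D)) := by
    refine intervalIntegral.integral_mono_on zero_le_one hfi
      (Continuous.intervalIntegrable (by fun_prop) 0 1) fun y hy => ?_
    nlinarith [h y hy, sq_nonneg (f y - 4 * c)]
  rwa [intervalIntegral.integral_add (by simp) ((hgi.mul_const _).const_mul _),
    intervalIntegral.integral_const, sub_zero, one_smul, intervalIntegral.integral_const_mul,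
    intervalIntegral.integral_mul_const, hgint] at hmono

/-- Coercivity of the boundary form when the curvature at the endpoint with value `p` is
nonpositive, given the Hölder and Poincaré bounds at the endpoints. -/
theorem boundary_form_coercive {s a b κ p q D F m : ℝ} (hs : 1 ≤ s) (ha : 0 < a) (hb : 0 < b)
    (hκ0 : κ ≤ 0) (hκ : -κ ≤ 2 * a + min 1 (Real.sqrt a) / (4 * s))
    (hd : (q - p) ^ 2 ≤ D) (hF : F ≤ 4 * q ^ 2 + 2 / 3 * D)
    (hm0 : 0 ≤ m) (hm1 : m ≤ 1) (hmb : m ≤ b) :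
    1 / 4 * m * (F + D) ≤
      3 / 4 * D + (2 * a + κ) * s * p ^ 2 + (2 * b - κ) * s * q ^ 2 := by
  have hs0 : 0 < s := by linarith
  have hD : 0 ≤ D := (sq_nonneg _).trans hd
  have hrhs : 1 / 4 * m * (F + D) ≤ b * q ^ 2 + 5 / 12 * D := by
    nlinarith [mul_le_mul_of_nonneg_left hF hm0, mul_le_mul_of_nonneg_right hm1 hD,
      mul_le_mul_of_nonneg_right hmb (sq_nonneg q)]
  have hbs : b ≤ b * s := le_mul_of_one_le_right hb.le hs
  rcases le_total 0 (2 * a + κ) with hA | hA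
  · have h1 : 0 ≤ (2 * a + κ) * s * p ^ 2 := by positivity
    have h2 : b * q ^ 2 ≤ (2 * b - κ) * s * q ^ 2 := by
      refine mul_le_mul_of_nonneg_right ?_ (sq_nonneg q)
      nlinarith [mul_nonneg (neg_nonneg.2 hκ0) hs0.le]
    linarith
  · obtain ⟨c, hc⟩ : ∃ c, c = -(2 * a + κ) * s := ⟨_, rfl⟩
    have hc0 : 0 ≤ c := hc ▸ mul_nonneg (by linarith) hs0.le
    have hcm : c ≤ min 1 (Real.sqrt a) / 4 := by
      have h := mul_le_mul_of_nonneg_right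
        (show -(2 * a + κ) ≤ min 1 (Real.sqrt a) / (4 * s) by linarith) hs0.le
      have e : min 1 (Real.sqrt a) / (4 * s) * s = min 1 (Real.sqrt a) / 4 := by field_simp
      rwa [e, ← hc] at h
    have hc1 : c ≤ 1 / 4 := by linarith [min_le_left 1 (Real.sqrt a)]
    have hc2 : c ^ 2 ≤ a / 16 := by
      have h : c ≤ Real.sqrt a / 4 := by linarith [min_le_right 1 (Real.sqrt a)]
      nlinarith [Real.sq_sqrt ha.le, Real.sqrt_nonneg a]
    have hcross : 0 ≤ (a + b) * q ^ 2 + 2 * c * q * (q - p) + (q - p) ^ 2 / 16 := by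
      refine nonneg_of_mul_nonneg_right (a := a + b) ?_ (by linarith)
      nlinarith [sq_nonneg ((a + b) * q + c * (q - p)),
        mul_nonneg (show 0 ≤ (a + b) / 16 - c ^ 2 by linarith) (sq_nonneg (q - p))]
    have hform : (2 * a + κ) * s * p ^ 2 + (2 * b - κ) * s * q ^ 2 =
        2 * ((a + b) * s) * q ^ 2 + 2 * c * q * (q - p) - c * (q - p) ^ 2 := by
      rw [hc]; ring
    have hS : (a + b) * q ^ 2 ≤ (a + b) * s * q ^ 2 :=
      mul_le_mul_of_nonneg_right (le_mul_of_one_le_right (by linarith) hs) (sq_nonneg q)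
    have hcd := mul_le_mul_of_nonneg_right hc1 (sq_nonneg (q - p))
    have haq : 0 ≤ a * q ^ 2 := by positivity
    linarith

/-- One-dimensional version of Lemma 3.2: under the smallness condition relating the
curvature values `κ₊ = −κ₋` to the friction coefficients, three quarters of the Dirichlet
energy plus the weighted boundary terms control a fixed fraction of the `H¹`-norm. -/
theorem stmt3 (s αm αp κm : ℝ) (hs : 1 ≤ s) (hαm : 0 < αm) (hαp : 0 < αp)
    (hκm : |κm| ≤ 2 * αm + min 1 (Real.sqrt αm) / (4 * s))
    (hκp : |(-κm)| ≤ 2 * αp + min 1 (Real.sqrt αp) / (4 * s))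
    (f f' : ℝ → ℝ)
    (hderiv : ∀ x ∈ Set.Icc (0:ℝ) 1, HasDerivWithinAt f (f' x) (Set.Icc (0:ℝ) 1) x)
    (hint : IntervalIntegrable (fun z => (f' z) ^ 2) MeasureTheory.volume 0 1) :
    (3 / 4) * (∫ z in (0:ℝ)..1, (f' z) ^ 2)
        + (2 * αm + κm) * s * f 0 ^ 2 + (2 * αp + (-κm)) * s * f 1 ^ 2 ≥
      (1 / 4) * min 1 (min αm αp) *
        ((∫ y in (0:ℝ)..1, f y ^ 2) + ∫ z in (0:ℝ)..1, (f' z) ^ 2) := by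
  have hHol {x y : ℝ} := sq_sub_le_mul_integral_sq_deriv (x := x) (y := y) hderiv hint
  have hcont : ContinuousOn f (Icc 0 1) := fun x hx => (hderiv x hx).continuousWithinAt
  set D := ∫ z in (0:ℝ)..1, (f' z) ^ 2
  have hd : (f 1 - f 0) ^ 2 ≤ D := by simpa using hHol le_rfl zero_le_one le_rfl
  have hF0 := integral_sq_le_of_sq_sub_le (c := f 0) (D := D) (w := 1 / 2) (g := fun y => y)
    hcont continuous_id (by norm_num)
    fun y hy => by simpa using hHol le_rfl hy.1 hy.2
  have hF1 := integral_sq_le_of_sq_sub_le (c := f 1) (D := D) (w := 1 / 2) (g := fun y => 1 - y)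
    hcont (by fun_prop)
    (by rw [intervalIntegral.integral_sub (by simp) (by simp)]; norm_num)
    fun y hy => by rw [sub_sq_comm]; exact hHol hy.1 hy.2 le_rfl
  have hm0 : 0 ≤ min 1 (min αm αp) := by positivity
  have hm1 : min 1 (min αm αp) ≤ 1 := min_le_left _ _
  have hmm : min 1 (min αm αp) ≤ αm := (min_le_right _ _).trans (min_le_left _ _)
  have hmp : min 1 (min αm αp) ≤ αp := (min_le_right _ _).trans (min_le_right _ _)
  rcases le_total κm 0 with hκ | hκ
  · have := boundary_form_coercive hs hαm hαp hκ ((neg_le_abs κm).trans hκm) hd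
      (F := ∫ y in (0:ℝ)..1, f y ^ 2) (by linarith) hm0 hm1 hmp
    linarith
  · have := boundary_form_coercive hs hαp hαm (neg_nonpos.2 hκ) ((neg_le_abs (-κm)).trans hκp)
      (sub_sq_comm (f 1) (f 0) ▸ hd) (F := ∫ y in (0:ℝ)..1, f y ^ 2) (by linarith) hm0 hm1 hmm
    linarith
end

section
/- Let a < b be real numbers, let f : [a,b] → ℝ be twice continuously differentiable with f(a) = 0 and ∫_a^b f'(z) dz = 0, and let g : [a,b] → ℝ be differentiable with g(a) = 0 and derivative g' whose square is integrable on [a,b]. Then for every δ ∈ (0, b−a] and every y ∈ [a, a+δ], |f(y)·g(y)| ≤ √2 · δ^{3/2} · (∫_a^b f'(z)² dz)^{1/4} · (∫_a^b f''(z)² dz)^{1/4} · (∫_a^b g'(z)² dz)^{1/2}. -/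
/-- Cauchy–Schwarz inequality for interval integrals, for either orientation of the interval. -/
theorem sq_intervalIntegral_mul_le {u v : ℝ → ℝ} {a b : ℝ}
    (hu : IntervalIntegrable (fun z => u z ^ 2) MeasureTheory.volume a b)
    (hv : IntervalIntegrable (fun z => v z ^ 2) MeasureTheory.volume a b)
    (huv : IntervalIntegrable (fun z => u z * v z) MeasureTheory.volume a b) :
    (∫ z in a..b, u z * v z) ^ 2 ≤ (∫ z in a..b, u z ^ 2) * ∫ z in a..b, v z ^ 2 := by
  wlog hab : a ≤ b generalizing a b
  · have h := this hu.symm hv.symm huv.symm (le_of_not_ge hab)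
    simp only [intervalIntegral.integral_symm a b] at h
    linarith
  have key : ∀ s : ℝ, 0 ≤ (∫ z in a..b, u z ^ 2) * (s * s) +
      (2 * ∫ z in a..b, u z * v z) * s + ∫ z in a..b, v z ^ 2 := by
    intro s
    have h : 0 ≤ ∫ z in a..b, (s * s * u z ^ 2 + 2 * s * (u z * v z) + v z ^ 2) :=
      intervalIntegral.integral_nonneg_of_forall hab fun z => by
        nlinarith [sq_nonneg (s * u z + v z)]
    rw [intervalIntegral.integral_add ((hu.const_mul _).add (huv.const_mul _)) hv,
      intervalIntegral.integral_add (hu.const_mul _) (huv.const_mul _),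
      intervalIntegral.integral_const_mul, intervalIntegral.integral_const_mul] at h
    linarith
  have h := discrim_le_zero key
  rw [discrim] at h
  linarith

/-- A function that is differentiable on `[a, b]` with square-integrable derivative and that
vanishes at `a` satisfies `g(y)² ≤ (y - a) ∫ g'²`. -/
theorem sq_le_sub_mul_integral_sq_deriv {a b : ℝ} {g g' : ℝ → ℝ}
    (hg : ∀ x ∈ Set.Icc a b, HasDerivWithinAt g (g' x) (Set.Icc a b) x) (hga : g a = 0)
    (hgint : IntervalIntegrable (fun z => g' z ^ 2) MeasureTheory.volume a b)
    {y : ℝ} (hy : y ∈ Set.Icc a b) :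
    g y ^ 2 ≤ (y - a) * ∫ z in a..b, g' z ^ 2 := by
  have hab : a ≤ b := hy.1.trans hy.2
  have hderiv : ∀ x ∈ Set.Ioo a b, HasDerivAt g (g' x) x := fun x hx =>
    (hg x (Set.Ioo_subset_Icc_self hx)).hasDerivAt (Icc_mem_nhds hx.1 hx.2)
  have hmeas : MeasureTheory.AEStronglyMeasurable g'
      (MeasureTheory.volume.restrict (Set.Ioc a b)) := by
    rw [← MeasureTheory.restrict_Ioo_eq_restrict_Ioc]
    refine (measurable_deriv g).aestronglyMeasurable.congr ?_
    filter_upwards [MeasureTheory.ae_restrict_mem measurableSet_Ioo] with x hx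
    exact (hderiv x hx).deriv
  have hint : IntervalIntegrable g' MeasureTheory.volume a b := by
    refine (intervalIntegrable_const (c := (1 : ℝ)).add hgint).mono_fun
      (by rwa [Set.uIoc_of_le hab]) (Filter.Eventually.of_forall fun z => ?_)
    simp only [Real.norm_eq_abs]
    refine le_trans ?_ (le_abs_self _)
    nlinarith [sq_abs (g' z), sq_nonneg (|g' z| - 1)]
  have hsub : Set.uIcc a y ⊆ Set.uIcc a b := by
    rw [Set.uIcc_of_le hy.1, Set.uIcc_of_le hab]
    exact Set.Icc_subset_Icc_right hy.2
  have hftc : ∫ z in a..y, g' z = g y := by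
    rw [intervalIntegral.integral_eq_sub_of_hasDerivAt_of_le hy.1
      (fun x hx => (hg x ⟨hx.1, hx.2.trans hy.2⟩).continuousWithinAt.mono
        (Set.Icc_subset_Icc_right hy.2))
      (fun x hx => hderiv x ⟨hx.1, hx.2.trans_le hy.2⟩) (hint.mono_set hsub), hga, sub_zero]
  have hcs := sq_intervalIntegral_mul_le (u := fun _ => 1) (v := g') (a := a) (b := y)
    (by simp) (hgint.mono_set hsub) (by simpa using hint.mono_set hsub)
  simp only [one_mul, one_pow, intervalIntegral.integral_const, smul_eq_mul, mul_one, hftc]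
    at hcs
  refine hcs.trans (mul_le_mul_of_nonneg_left ?_ (sub_nonneg.2 hy.1))
  exact intervalIntegral.integral_mono_interval le_rfl hy.1 hy.2
    (Filter.Eventually.of_forall fun z => sq_nonneg _) hgint

/-- Agmon-type bound: if `h` is continuously differentiable on `[a, b]` and vanishes somewhere
in `[a, b]`, then `h(x)⁴ ≤ 4 (∫ h²) (∫ h'²)`. -/
theorem pow_four_le_integral_sq_mul_integral_sq_deriv {a b : ℝ} {h h' : ℝ → ℝ}
    (hh : ∀ x ∈ Set.Icc a b, HasDerivWithinAt h (h' x) (Set.Icc a b) x)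
    (hh' : ContinuousOn h' (Set.Icc a b)) {c x : ℝ} (hc : c ∈ Set.Icc a b) (hhc : h c = 0)
    (hx : x ∈ Set.Icc a b) :
    h x ^ 4 ≤ 4 * ((∫ z in a..b, h z ^ 2) * ∫ z in a..b, h' z ^ 2) := by
  have hab : a ≤ b := hx.1.trans hx.2
  have hcont : ContinuousOn h (Set.Icc a b) := fun z hz => (hh z hz).continuousWithinAt
  have hsub : Set.uIcc c x ⊆ Set.Icc a b := Set.uIcc_subset_Icc hc hx
  have hftc : ∫ z in c..x, 2 * (h z * h' z) = h x ^ 2 := by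
    have hint : IntervalIntegrable (fun z => 2 * (h z * h' z)) MeasureTheory.volume c x :=
      (((hcont.mono hsub).mul (hh'.mono hsub)).const_mul 2).intervalIntegrable
    rw [intervalIntegral.integral_eq_sub_of_hasDeriv_right (f := fun z => h z ^ 2)
      ((hcont.mono hsub).pow 2) (fun z hz => ?_) hint]
    · simp [hhc]
    · have hz' : z ∈ Set.Ioo a b :=
        ⟨(le_min hc.1 hx.1).trans_lt hz.1, hz.2.trans_le (max_le hc.2 hx.2)⟩
      have hd := ((hh z (Set.Ioo_subset_Icc_self hz')).hasDerivAt
        (Icc_mem_nhds hz'.1 hz'.2)).pow 2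
      refine (hd.congr_deriv ?_).hasDerivWithinAt
      push_cast
      ring
  have hmono : ∀ w : ℝ → ℝ, ContinuousOn w (Set.Icc a b) →
      |∫ z in c..x, w z ^ 2| ≤ ∫ z in a..b, w z ^ 2 := by
    intro w hw
    have hpos : 0 ≤ ∫ z in a..b, w z ^ 2 :=
      intervalIntegral.integral_nonneg_of_forall hab fun z => sq_nonneg _
    rw [← abs_of_nonneg hpos]
    refine intervalIntegral.abs_integral_mono_interval ?_
      (Filter.Eventually.of_forall fun z => sq_nonneg _)
      ((hw.pow 2).intervalIntegrable_of_Icc hab)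
    rw [Set.uIoc_of_le hab]
    exact Set.Ioc_subset_Ioc (le_min hc.1 hx.1) (max_le hc.2 hx.2)
  have hcs := sq_intervalIntegral_mul_le (u := h) (v := h') (a := c) (b := x)
    ((hcont.mono hsub).pow 2).intervalIntegrable ((hh'.mono hsub).pow 2).intervalIntegrable
    ((hcont.mono hsub).mul (hh'.mono hsub)).intervalIntegrable
  rw [intervalIntegral.integral_const_mul] at hftc
  calc h x ^ 4 = 4 * (∫ z in c..x, h z * h' z) ^ 2 := by
        rw [show h x ^ 4 = (h x ^ 2) ^ 2 by ring, ← hftc]; ring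
    _ ≤ 4 * (|∫ z in c..x, h z ^ 2| * |∫ z in c..x, h' z ^ 2|) := by
        rw [← abs_mul]
        exact mul_le_mul_of_nonneg_left (hcs.trans (le_abs_self _)) (by norm_num)
    _ ≤ 4 * ((∫ z in a..b, h z ^ 2) * ∫ z in a..b, h' z ^ 2) := by
        have h1 := hmono h hcont
        have h2 := hmono h' hh'
        gcongr
        exact (abs_nonneg _).trans h1


/-- One-dimensional core of Lemma 4.2: for `f` twice continuously differentiable with
`f(a) = 0` and `∫_a^b f' = 0`, and `g` differentiable with `g(a) = 0`, one has for every
`δ ∈ (0, b−a]` and `y ∈ [a, a+δ]` the bound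
`|f(y)·g(y)| ≤ √2·δ^{3/2}·‖f'‖_{L²}^{1/2}·‖f''‖_{L²}^{1/2}·‖g'‖_{L²}`. -/
theorem stmt7 (a b : ℝ) (hab : a < b) (f f' f'' g g' : ℝ → ℝ)
    (hf : ∀ x ∈ Set.Icc a b, HasDerivWithinAt f (f' x) (Set.Icc a b) x)
    (hf' : ∀ x ∈ Set.Icc a b, HasDerivWithinAt f' (f'' x) (Set.Icc a b) x)
    (hf'' : ContinuousOn f'' (Set.Icc a b))
    (hfa : f a = 0) (hmean : (∫ z in a..b, f' z) = 0)
    (hg : ∀ x ∈ Set.Icc a b, HasDerivWithinAt g (g' x) (Set.Icc a b) x)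
    (hga : g a = 0)
    (hgint : IntervalIntegrable (fun z => (g' z) ^ 2) MeasureTheory.volume a b) :
    ∀ δ ∈ Set.Ioc (0:ℝ) (b - a), ∀ y ∈ Set.Icc a (a + δ),
      |f y * g y| ≤ Real.sqrt 2 * δ ^ ((3:ℝ)/2) *
        (∫ z in a..b, (f' z) ^ 2) ^ ((1:ℝ)/4) * (∫ z in a..b, (f'' z) ^ 2) ^ ((1:ℝ)/4) *
        (∫ z in a..b, (g' z) ^ 2) ^ ((1:ℝ)/2) := by
  intro δ hδ y hy
  have hyb : y ∈ Set.Icc a b := ⟨hy.1, by linarith [hy.2, hδ.2]⟩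
  have hyδ : y - a ≤ δ := by linarith [hy.2]
  have haI : a ∈ Set.Icc a b := Set.left_mem_Icc.2 hab.le
  have hfcont : ContinuousOn f (Set.Icc a b) := fun z hz => (hf z hz).continuousWithinAt
  have hf'cont : ContinuousOn f' (Set.Icc a b) := fun z hz => (hf' z hz).continuousWithinAt
  have hderiv : ∀ x ∈ Set.Ioo a b, HasDerivAt f (f' x) x := fun x hx =>
    (hf x (Set.Ioo_subset_Icc_self hx)).hasDerivAt (Icc_mem_nhds hx.1 hx.2)
  have hfab : f a = f b := by
    rw [intervalIntegral.integral_eq_sub_of_hasDerivAt_of_le hab.le hfcont hderiv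
      (hf'cont.intervalIntegrable_of_Icc hab.le)] at hmean
    linarith
  obtain ⟨c, hc, hfc⟩ := exists_hasDerivAt_eq_zero hab hfcont hfab hderiv
  set A := ∫ z in a..b, f' z ^ 2
  set B := ∫ z in a..b, f'' z ^ 2
  set G := ∫ z in a..b, g' z ^ 2
  have hA : 0 ≤ A := intervalIntegral.integral_nonneg_of_forall hab.le fun z => sq_nonneg _
  have hB : 0 ≤ B := intervalIntegral.integral_nonneg_of_forall hab.le fun z => sq_nonneg _
  have hG : 0 ≤ G := intervalIntegral.integral_nonneg_of_forall hab.le fun z => sq_nonneg _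
  have hroot : ∀ t : ℝ, 0 ≤ t → (t ^ ((1:ℝ)/4)) ^ 4 = t := fun t ht => by
    rw [← Real.rpow_natCast, ← Real.rpow_mul ht]
    norm_num
  set M := Real.sqrt 2 * A ^ ((1:ℝ)/4) * B ^ ((1:ℝ)/4)
  have hM : 0 ≤ M := by positivity
  have hM4 : M ^ 4 = 4 * (A * B) := by
    rw [mul_pow, mul_pow, hroot A hA, hroot B hB,
      show Real.sqrt 2 ^ 4 = (Real.sqrt 2 ^ 2) ^ 2 by ring, Real.sq_sqrt (by norm_num)]
    ring
  have hbound : ∀ x ∈ Set.Icc a b, ‖f' x‖ ≤ M := fun x hx => by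
    refine le_of_pow_le_pow_left₀ (n := 4) (by norm_num) hM ?_
    rw [hM4, Real.norm_eq_abs, Even.pow_abs (by decide)]
    exact pow_four_le_integral_sq_mul_integral_sq_deriv hf' hf''
      (Set.Ioo_subset_Icc_self hc) hfc hx
  have hfy : |f y| ≤ δ * M := by
    have h := (convex_Icc a b).norm_image_sub_le_of_norm_hasDerivWithin_le hf hbound haI hyb
    rw [hfa, sub_zero, Real.norm_eq_abs, Real.norm_eq_abs,
      abs_of_nonneg (sub_nonneg.2 hy.1), mul_comm] at h
    exact h.trans (mul_le_mul_of_nonneg_right hyδ hM)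
  have hgy : |g y| ≤ δ ^ ((1:ℝ)/2) * G ^ ((1:ℝ)/2) := by
    rw [← Real.mul_rpow hδ.1.le hG, ← Real.sqrt_eq_rpow]
    exact Real.abs_le_sqrt ((sq_le_sub_mul_integral_sq_deriv hg hga hgint hyb).trans
      (mul_le_mul_of_nonneg_right hyδ hG))
  have hδpow : δ ^ ((3:ℝ)/2) = δ * δ ^ ((1:ℝ)/2) := by
    rw [show (3:ℝ)/2 = 1 + 1/2 by norm_num, Real.rpow_add hδ.1, Real.rpow_one]
  calc |f y * g y| = |f y| * |g y| := abs_mul _ _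
    _ ≤ (δ * M) * (δ ^ ((1:ℝ)/2) * G ^ ((1:ℝ)/2)) :=
        mul_le_mul hfy hgy (abs_nonneg _) (mul_nonneg hδ.1.le hM)
    _ = _ := by rw [hδpow]; ring
end

section
/- Let h : ℝ → ℝ be differentiable with h' differentiable at t ∈ ℝ, and set γ(t) = (t, h(t)), τ(t) = (1, h'(t))/√(1+h'(t)²), n(t) = (−h'(t), 1)/√(1+h'(t)²), κ(t) = h''(t)/(1+h'(t)²)^{3/2}. Let u : ℝ² → ℝ² be differentiable in a neighborhood of γ(t) and suppose u(γ(s))·n(s) = 0 for all s in a neighborhood of t. Then n(t) · (Du(γ(t))[u(γ(t))]) = κ(t)·(u(γ(t))·τ(t))², where Du(p)[v] ∈ ℝ² denotes the Fréchet derivative of u at p applied to v (so that Du[u] is the advection term (u·∇)u). -/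
/-- If `u` satisfies the tangency relation `u₂ = h' u₁` along the graph of `h` near the abscissa
`t`, then `(u·∇)u` paired with the unnormalized normal `(-h', 1)` equals `h'' u₁²`. -/
theorem fderiv_apply_self_of_tangent_graph {h h' : ℝ → ℝ} {h'' t : ℝ}
    (hd : HasDerivAt h (h' t) t) (hd' : HasDerivAt h' h'' t) {u : ℝ × ℝ → ℝ × ℝ}
    (hu : DifferentiableAt ℝ u (t, h t))
    (hbc : ∀ᶠ s in nhds t, (u (s, h s)).2 = h' s * (u (s, h s)).1) :
    (fderiv ℝ u (t, h t) (u (t, h t))).2 - h' t * (fderiv ℝ u (t, h t) (u (t, h t))).1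
      = h'' * (u (t, h t)).1 ^ 2 := by
  have hcomp : HasDerivAt (fun s => u (s, h s)) (fderiv ℝ u (t, h t) (1, h' t)) t :=
    hu.hasFDerivAt.comp_hasDerivAt t ((hasDerivAt_id t).prodMk hd)
  have hder : (fderiv ℝ u (t, h t) (1, h' t)).2
      = h'' * (u (t, h t)).1 + h' t * (fderiv ℝ u (t, h t) (1, h' t)).1 :=
    (hasFDerivAt_snd.comp_hasDerivAt t hcomp).unique
      ((hd'.mul (hasFDerivAt_fst.comp_hasDerivAt t hcomp)).congr_of_eventuallyEq hbc)
  have hsplit : u (t, h t) = (u (t, h t)).1 • ((1, h' t) : ℝ × ℝ) :=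
    Prod.ext (by simp) (by simpa [mul_comm] using hbc.self_of_nhds)
  have hlin : fderiv ℝ u (t, h t) (u (t, h t))
      = (u (t, h t)).1 • fderiv ℝ u (t, h t) (1, h' t) := by
    rw [← map_smul, ← hsplit]
  rw [hlin, Prod.smul_fst, Prod.smul_snd, smul_eq_mul, smul_eq_mul, hder]
  ring


/-- Identity `n·(u·∇)u = κ·u_τ²` (appendix (A.5) of the paper): for a vector field `u`
tangent to the graph boundary `y₂ = h(y₁)`, the normal component of the self-advection
`(u·∇)u` along the boundary equals the curvature times the square of the tangential
velocity. -/
theorem stmt10 (h h' : ℝ → ℝ) (h'' t : ℝ)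
    (hd : ∀ s, HasDerivAt h (h' s) s)
    (hd' : HasDerivAt h' h'' t)
    (u : ℝ × ℝ → ℝ × ℝ)
    (γ : ℝ → ℝ × ℝ) (hγ : γ = fun s => (s, h s))
    (hu : ∀ᶠ p in nhds (γ t), DifferentiableAt ℝ u p)
    (τ : ℝ → ℝ × ℝ)
    (hτ : τ = fun s => (1 / Real.sqrt (1 + h' s ^ 2), h' s / Real.sqrt (1 + h' s ^ 2)))
    (n : ℝ → ℝ × ℝ)
    (hn : n = fun s => (-h' s / Real.sqrt (1 + h' s ^ 2), 1 / Real.sqrt (1 + h' s ^ 2)))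
    (κ : ℝ) (hκ : κ = h'' / (1 + h' t ^ 2) ^ ((3:ℝ)/2))
    (hbc : ∀ᶠ s in nhds t, (u (γ s)).1 * (n s).1 + (u (γ s)).2 * (n s).2 = 0) :
    (n t).1 * (fderiv ℝ u (γ t) (u (γ t))).1 + (n t).2 * (fderiv ℝ u (γ t) (u (γ t))).2
      = κ * ((u (γ t)).1 * (τ t).1 + (u (γ t)).2 * (τ t).2) ^ 2 := by
  subst hγ hτ hn hκ
  have hpos (s : ℝ) : 0 < Real.sqrt (1 + h' s ^ 2) := Real.sqrt_pos.2 (by positivity)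
  have htan : ∀ᶠ s in nhds t, (u (s, h s)).2 = h' s * (u (s, h s)).1 := by
    filter_upwards [hbc] with s hs
    have hne := (hpos s).ne'
    field_simp at hs
    linarith
  have key := fderiv_apply_self_of_tangent_graph (hd t) hd' hu.self_of_nhds htan
  have hsq : Real.sqrt (1 + h' t ^ 2) ^ 2 = 1 + h' t ^ 2 := Real.sq_sqrt (by positivity)
  have hpow : (1 + h' t ^ 2) ^ ((3 : ℝ) / 2) = Real.sqrt (1 + h' t ^ 2) ^ 3 := by
    rw [Real.sqrt_eq_rpow, ← Real.rpow_mul_natCast (by positivity)]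
    norm_num
  have hspeed : (u (t, h t)).1 * (1 / Real.sqrt (1 + h' t ^ 2))
      + (u (t, h t)).2 * (h' t / Real.sqrt (1 + h' t ^ 2))
      = (u (t, h t)).1 * Real.sqrt (1 + h' t ^ 2) := by
    have hne := (hpos t).ne'
    rw [htan.self_of_nhds]
    field_simp
    rw [hsq]
  have hne := (hpos t).ne'
  dsimp only
  rw [hspeed, hpow]
  calc
    _ = ((fderiv ℝ u (t, h t) (u (t, h t))).2
          - h' t * (fderiv ℝ u (t, h t) (u (t, h t))).1) / Real.sqrt (1 + h' t ^ 2) := by ring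
    _ = _ := by
      rw [key]
      field_simp
end
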